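/- arXiv:1801.09245 — 4 statements merged into one kernel-verified Lean document; each statement's English description precedes it below -/
import Mathlib

section
/- Let d ≥ 1, 0 < p < ∞, ρ ∈ ℝ, and let f : ℤ^d → ℝ be finitely supported and not identically zero. Then ∑_{j≥0} 2^{j(τp − d + dp)} ∑_{k∈ℤ^d} ⟨2^{−j}k⟩^{ρp} |f(k)|^p < ∞ if and only if τ < d/p − d. -/
open MeasureTheory ENNReal

/-- The Japanese bracket `⟨x⟩ = (1 + ‖x‖²)^{1/2}` on Euclidean space. -/
noncomputable def jb {d : ℕ} (x : EuclideanSpace ℝ (Fin d)) : ℝ := Real.sqrt (1 + ‖x‖ ^ 2)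

/-- The point `2^{-j} k ∈ ℝ^d` for `k ∈ ℤ^d`. -/
noncomputable def pt (d : ℕ) (j : ℕ) (k : Fin d → ℤ) : EuclideanSpace ℝ (Fin d) :=
  (EuclideanSpace.equiv (Fin d) ℝ).symm fun i => (k i : ℝ) / 2 ^ j

theorem pt_eq_smul (d j : ℕ) (k : Fin d → ℤ) :
    pt d j k = ((2 : ℝ) ^ j)⁻¹ • pt d 0 k := by
  ext i
  simp [pt, div_eq_inv_mul]

theorem norm_pt_le (d j : ℕ) (k : Fin d → ℤ) : ‖pt d j k‖ ≤ ‖pt d 0 k‖ := by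
  rw [pt_eq_smul, norm_smul, norm_inv, norm_pow, Real.norm_ofNat]
  exact mul_le_of_le_one_left (norm_nonneg _) (inv_le_one_of_one_le₀ (one_le_pow₀ one_le_two))

theorem one_le_jb {d : ℕ} (x : EuclideanSpace ℝ (Fin d)) : 1 ≤ jb x :=
  Real.one_le_sqrt.2 (le_add_of_nonneg_right (sq_nonneg _))

theorem jb_pt_le (d j : ℕ) (k : Fin d → ℤ) : jb (pt d j k) ≤ jb (pt d 0 k) := by
  have := norm_pt_le d j k
  unfold jb
  gcongr

theorem rpow_le_max_one_rpow {x y : ℝ} (hx : 1 ≤ x) (hxy : x ≤ y) (a : ℝ) :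
    x ^ a ≤ max 1 (y ^ a) := by
  rcases le_total 0 a with ha | ha
  · exact le_max_of_le_right (Real.rpow_le_rpow (by linarith) hxy ha)
  · exact le_max_of_le_left (Real.rpow_le_one_of_one_le_of_nonpos hx ha)

theorem min_one_rpow_le_rpow {x y : ℝ} (hx : 1 ≤ x) (hxy : x ≤ y) (a : ℝ) :
    min 1 (y ^ a) ≤ x ^ a := by
  rcases le_total 0 a with ha | ha
  · exact min_le_of_left_le (Real.one_le_rpow hx ha)
  · exact min_le_of_right_le (Real.rpow_le_rpow_of_nonpos (by linarith) hxy ha)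

theorem tsum_two_rpow_lt_top_iff (c : ℝ) :
    ∑' j : ℕ, ENNReal.ofReal ((2 : ℝ) ^ ((j : ℝ) * c)) < ⊤ ↔ c < 0 := by
  have h (j : ℕ) : ENNReal.ofReal ((2 : ℝ) ^ ((j : ℝ) * c)) = ENNReal.ofReal (2 ^ c) ^ j := by
    rw [← ENNReal.ofReal_pow (by positivity), mul_comm, Real.rpow_mul_natCast zero_le_two]
  simp_rw [h]
  rw [ENNReal.tsum_geometric, ENNReal.inv_lt_top, tsub_pos_iff_lt, ENNReal.ofReal_lt_one]
  simpa using Real.rpow_lt_rpow_left_iff (y := c) (z := 0) one_lt_two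

theorem tsum_ofReal_mul_abs_rpow_ne_top {ι : Type*} {f : ι → ℝ}
    (hfin : (Function.support f).Finite) {p : ℝ} (hp : 0 < p) (w : ι → ℝ) :
    ∑' k, ENNReal.ofReal (w k * |f k| ^ p) ≠ ⊤ := by
  rw [tsum_eq_sum (s := hfin.toFinset)]
  · exact ENNReal.sum_ne_top.2 fun _ _ => ENNReal.ofReal_ne_top
  · intro k hk
    have : f k = 0 := by simpa using hk
    simp [this, Real.zero_rpow hp.ne']

theorem tsum_mul_lt_top_iff_of_bounds {a S : ℕ → ℝ≥0∞} {m M : ℝ≥0∞} (hm : m ≠ 0) (hM : M ≠ ⊤)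
    (hmS : ∀ j, m ≤ S j) (hSM : ∀ j, S j ≤ M) :
    ∑' j, a j * S j < ⊤ ↔ ∑' j, a j < ⊤ := by
  constructor <;> intro h
  · have h' : (∑' j, a j) * m < ⊤ := by
      rw [← ENNReal.tsum_mul_right]
      exact (ENNReal.tsum_le_tsum fun j => mul_le_mul_right (hmS j) _).trans_lt h
    exact ENNReal.lt_top_of_mul_ne_top_left h'.ne hm
  · refine (ENNReal.tsum_le_tsum fun j => mul_le_mul_right (hSM j) (a j)).trans_lt ?_
    rw [ENNReal.tsum_mul_right]
    exact ENNReal.mul_lt_top h hM.lt_top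

/-- For a finitely supported, not identically zero `f : ℤ^d → ℝ`, the weighted Besov-type
double series `∑_j 2^{j(τp - d + dp)} ∑_k ⟨2^{-j}k⟩^{ρp} |f(k)|^p` is finite if and only if
`τ < d/p - d`. (Sequence form of the Besov localization of the Dirac impulse.) -/
theorem dirac_besov_sequence
    (d : ℕ) (hd : 1 ≤ d) (p : ℝ) (hp : 0 < p) (τ ρ : ℝ)
    (f : (Fin d → ℤ) → ℝ) (hfin : (Function.support f).Finite) (hf : f ≠ 0) :
    (∑' j : ℕ, ENNReal.ofReal ((2 : ℝ) ^ ((j : ℝ) * (τ * p - d + d * p))) *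
        ∑' k : Fin d → ℤ,
          ENNReal.ofReal (jb (pt d j k) ^ (ρ * p) * |f k| ^ p)) < ⊤
      ↔ τ < d / p - d := by
  have hm : ∑' k : Fin d → ℤ,
      ENNReal.ofReal (min 1 (jb (pt d 0 k) ^ (ρ * p)) * |f k| ^ p) ≠ 0 := by
    obtain ⟨k, hk⟩ := Function.ne_iff.1 hf
    have hJ := zero_lt_one.trans_le (one_le_jb (pt d 0 k))
    have hk' : 0 < |f k| := abs_pos.2 hk
    have hpos : 0 < min 1 (jb (pt d 0 k) ^ (ρ * p)) * |f k| ^ p :=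
      mul_pos (lt_min one_pos (Real.rpow_pos_of_pos hJ _)) (Real.rpow_pos_of_pos hk' _)
    exact fun h => (ENNReal.ofReal_pos.2 hpos).ne' (ENNReal.tsum_eq_zero.1 h k)
  rw [tsum_mul_lt_top_iff_of_bounds hm (tsum_ofReal_mul_abs_rpow_ne_top hfin hp
      fun k => max 1 (jb (pt d 0 k) ^ (ρ * p))), tsum_two_rpow_lt_top_iff]
  · rw [lt_sub_iff_add_lt, lt_div_iff₀ hp]
    constructor <;> intro h <;> linarith
  · intro j
    refine ENNReal.tsum_le_tsum fun k => ENNReal.ofReal_le_ofReal ?_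
    gcongr
    exact min_one_rpow_le_rpow (one_le_jb _) (jb_pt_le d j k) _
  · intro j
    refine ENNReal.tsum_le_tsum fun k => ENNReal.ofReal_le_ofReal ?_
    gcongr
    exact rpow_le_max_one_rpow (one_le_jb _) (jb_pt_le d j k) _
end

section
/- Let d ≥ 1, 0 < p₀ ≤ p₁ < ∞, and τ₀, τ₁, ρ₀, ρ₁ ∈ ℝ with τ₀ − τ₁ > d/p₀ − d/p₁ and ρ₀ > ρ₁. Then for every family (a_{j,k})_{j∈ℕ, k∈ℤ^d} of real numbers, the finiteness of ∑_{j≥0} 2^{j(τ₀p₀ − d + dp₀/2)} ∑_{k∈ℤ^d} ⟨2^{−j}k⟩^{ρ₀p₀} |a_{j,k}|^{p₀} implies the finiteness of ∑_{j≥0} 2^{j(τ₁p₁ − d + dp₁/2)} ∑_{k∈ℤ^d} ⟨2^{−j}k⟩^{ρ₁p₁} |a_{j,k}|^{p₁}. -/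
open MeasureTheory ENNReal

theorem ENNReal.tsum_rpow_le_rpow_tsum {ι : Type*} (f : ι → ℝ≥0∞) {q : ℝ} (hq : 1 ≤ q) :
    ∑' i, f i ^ q ≤ (∑' i, f i) ^ q := by
  have split (x : ℝ≥0∞) : x ^ q = x * x ^ (q - 1) := by
    conv_lhs => rw [show q = 1 + (q - 1) by ring]
    rw [ENNReal.rpow_add_of_nonneg _ _ zero_le_one (sub_nonneg.2 hq), ENNReal.rpow_one]
  calc ∑' i, f i ^ q = ∑' i, f i * f i ^ (q - 1) := by simp only [split]
    _ ≤ ∑' i, f i * (∑' i, f i) ^ (q - 1) := by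
        refine ENNReal.tsum_le_tsum fun i => ?_
        have := sub_nonneg.2 hq
        gcongr
        exact ENNReal.le_tsum i
    _ = (∑' i, f i) ^ q := by rw [ENNReal.tsum_mul_right, ← split]

/-- Termwise comparison of the weighted Besov sequence norms: the integrability exponent is
raised from `p₀` to `p₁` at the cost of a power `p₁ / p₀`. -/
theorem besov_term_le_rpow {d p₀ p₁ τ₀ τ₁ ρ₀ ρ₁ b x : ℝ} (hp₀ : 0 < p₀) (hp₁ : 0 < p₁)
    (hτ : d / p₀ - d / p₁ ≤ τ₀ - τ₁) (hρ : ρ₁ ≤ ρ₀) (hb : 1 ≤ b) (hx : 0 ≤ x) (j : ℕ) :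
    (2 : ℝ) ^ ((j : ℝ) * (τ₁ * p₁ - d + d * p₁ / 2)) * (b ^ (ρ₁ * p₁) * x ^ p₁) ≤
      ((2 : ℝ) ^ ((j : ℝ) * (τ₀ * p₀ - d + d * p₀ / 2)) * (b ^ (ρ₀ * p₀) * x ^ p₀)) ^
        (p₁ / p₀) := by
  have hb0 : 0 ≤ b := zero_le_one.trans hb
  have hexp : τ₁ * p₁ - d + d * p₁ / 2 ≤ (τ₀ * p₀ - d + d * p₀ / 2) * (p₁ / p₀) := by
    have h := mul_le_mul_of_nonneg_right hτ hp₁.le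
    have e₁ : (d / p₀ - d / p₁) * p₁ = d * p₁ / p₀ - d := by field_simp
    have e₂ : (τ₀ * p₀ - d + d * p₀ / 2) * (p₁ / p₀) = τ₀ * p₁ - d * p₁ / p₀ + d * p₁ / 2 := by
      field_simp
    linarith
  rw [Real.mul_rpow (by positivity) (by positivity), Real.mul_rpow (by positivity) (by positivity),
    ← Real.rpow_mul zero_le_two, ← Real.rpow_mul hb0, ← Real.rpow_mul hx, mul_assoc (j : ℝ),
    mul_assoc ρ₀, mul_div_cancel₀ p₁ hp₀.ne']
  gcongr
  exact one_le_two

/-- Sequence form of the first weighted Besov embedding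
`B_{p₀}^{τ₀}(ℝ^d;ρ₀) ⊆ B_{p₁}^{τ₁}(ℝ^d;ρ₁)` when `τ₀ - τ₁ > d/p₀ - d/p₁` and `ρ₀ > ρ₁`. -/
theorem besov_sequence_embedding_one
    (d : ℕ) (hd : 1 ≤ d) (p₀ p₁ : ℝ) (hp₀ : 0 < p₀) (hp : p₀ ≤ p₁)
    (τ₀ τ₁ ρ₀ ρ₁ : ℝ) (hτ : d / p₀ - d / p₁ < τ₀ - τ₁) (hρ : ρ₁ < ρ₀)
    (a : ℕ → (Fin d → ℤ) → ℝ)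
    (hfin : (∑' j : ℕ, ENNReal.ofReal ((2 : ℝ) ^ ((j : ℝ) * (τ₀ * p₀ - d + d * p₀ / 2))) *
        ∑' k : Fin d → ℤ,
          ENNReal.ofReal (jb (pt d j k) ^ (ρ₀ * p₀) * |a j k| ^ p₀)) < ⊤) :
    (∑' j : ℕ, ENNReal.ofReal ((2 : ℝ) ^ ((j : ℝ) * (τ₁ * p₁ - d + d * p₁ / 2))) *
        ∑' k : Fin d → ℤ,
          ENNReal.ofReal (jb (pt d j k) ^ (ρ₁ * p₁) * |a j k| ^ p₁)) < ⊤ := by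
  have hp₁ : 0 < p₁ := hp₀.trans_le hp
  have hq : 1 ≤ p₁ / p₀ := (one_le_div hp₀).2 hp
  simp only [← ENNReal.tsum_mul_left] at hfin ⊢
  rw [← ENNReal.tsum_prod] at hfin ⊢
  refine lt_of_le_of_lt ?_ (ENNReal.rpow_lt_top_of_nonneg (zero_le_one.trans hq) hfin.ne)
  refine le_trans (ENNReal.tsum_le_tsum fun i => ?_) (ENNReal.tsum_rpow_le_rpow_tsum _ hq)
  have hb : 1 ≤ jb (pt d i.1 i.2) := one_le_jb _
  have hb0 : 0 ≤ jb (pt d i.1 i.2) := zero_le_one.trans hb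
  rw [← ENNReal.ofReal_mul (by positivity), ← ENNReal.ofReal_mul (by positivity),
    ENNReal.ofReal_rpow_of_nonneg (by positivity) (zero_le_one.trans hq)]
  exact ENNReal.ofReal_le_ofReal
    (besov_term_le_rpow hp₀ hp₁ hτ.le hρ.le hb (abs_nonneg _) i.1)
end

section
/- Let d ≥ 1, 0 < p₀ ≤ p₁ < ∞, and τ₀, τ₁, ρ₀, ρ₁ ∈ ℝ with ρ₁ − ρ₀ > d/p₀ − d/p₁ and τ₁ > τ₀. Then for every family (a_{j,k})_{j∈ℕ, k∈ℤ^d} of real numbers, the finiteness of ∑_{j≥0} 2^{j(τ₁p₁ − d + dp₁/2)} ∑_{k∈ℤ^d} ⟨2^{−j}k⟩^{ρ₁p₁} |a_{j,k}|^{p₁} implies the finiteness of ∑_{j≥0} 2^{j(τ₀p₀ − d + dp₀/2)} ∑_{k∈ℤ^d} ⟨2^{−j}k⟩^{ρ₀p₀} |a_{j,k}|^{p₀}. -/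
open MeasureTheory ENNReal

theorem ENNReal.tsum_pi_fin_prod {α : Type*} (f : α → ℝ≥0∞) (d : ℕ) :
    ∑' k : Fin d → α, ∏ i, f (k i) = (∑' m, f m) ^ d := by
  induction d with
  | zero => simp
  | succ n ih =>
    rw [← (Fin.consEquiv fun _ : Fin (n + 1) => α).tsum_eq, ENNReal.tsum_prod']
    simp only [Fin.consEquiv_apply, Fin.prod_univ_succ, Fin.cons_zero, Fin.cons_succ,
      ENNReal.tsum_mul_left, ENNReal.tsum_mul_right, ih, pow_succ']

theorem ENNReal.tsum_int_ediv (f : ℤ → ℝ≥0∞) (n : ℕ) [NeZero n] :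
    ∑' m : ℤ, f (m / n) = n * ∑' q, f q := by
  rw [← (Int.divModEquiv n).symm.tsum_eq, ENNReal.tsum_prod']
  have h (q : ℤ) (r : Fin n) : (((Int.divModEquiv n).symm (q, r) : ℤ) / n) = q :=
    congrArg Prod.fst ((Int.divModEquiv n).apply_symm_apply (q, r))
  simp only [h, tsum_fintype, Finset.sum_const, Finset.card_univ, Fintype.card_fin, nsmul_eq_mul,
    ENNReal.tsum_mul_left]

theorem norm_le_jb {d : ℕ} (x : EuclideanSpace ℝ (Fin d)) : ‖x‖ ≤ jb x :=
  Real.le_sqrt_of_sq_le (by linarith)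

theorem abs_ediv_add_half_le_jb {d : ℕ} (j : ℕ) (k : Fin d → ℤ) (i : Fin d) :
    |((k i / ((2 ^ j : ℕ) : ℤ) : ℤ) : ℝ) + 1 / 2| / 2 ≤ jb (pt d j k) := by
  have h1 := one_le_jb (pt d j k)
  have h2 := norm_le_jb (pt d j k)
  have h3 : |(k i : ℝ) / 2 ^ j| ≤ ‖pt d j k‖ := PiLp.norm_apply_le (pt d j k) i
  have hfl : ⌊(k i : ℝ) / 2 ^ j⌋ = k i / ((2 ^ j : ℕ) : ℤ) := by
    have := Int.floor_div_natCast (k i : ℝ) (2 ^ j)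
    simpa using this
  rw [← hfl]
  have h4 := Int.floor_le ((k i : ℝ) / 2 ^ j)
  have h5 := Int.lt_floor_add_one ((k i : ℝ) / 2 ^ j)
  have h6 := abs_le.1 (h3.trans h2)
  have : |(⌊(k i : ℝ) / 2 ^ j⌋ : ℝ) + 1 / 2| ≤ 2 * jb (pt d j k) := by
    rw [abs_le]; constructor <;> linarith
  linarith

theorem jb_rpow_neg_le_prod {d : ℕ} (hd : 1 ≤ d) {s : ℝ} (hs : 0 ≤ s) (j : ℕ) (k : Fin d → ℤ) :
    ENNReal.ofReal (jb (pt d j k) ^ (-s)) ≤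
      ∏ i, ENNReal.ofReal
        ((|((k i / ((2 ^ j : ℕ) : ℤ) : ℤ) : ℝ) + 1 / 2| / 2) ^ (-(s / d))) := by
  have hJ : 0 ≤ jb (pt d j k) := zero_le_one.trans (one_le_jb _)
  have hd0 : (d : ℝ) ≠ 0 := by positivity
  have hprod : jb (pt d j k) ^ (-s) = ∏ _i : Fin d, jb (pt d j k) ^ (-(s / d)) := by
    rw [Finset.prod_const, Finset.card_univ, Fintype.card_fin, ← Real.rpow_mul_natCast hJ]
    congr 1
    field_simp
  rw [hprod, ENNReal.ofReal_prod_of_nonneg fun _ _ => Real.rpow_nonneg hJ _]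
  refine Finset.prod_le_prod' fun i _ => ENNReal.ofReal_le_ofReal ?_
  refine Real.rpow_le_rpow_of_nonpos ?_ (abs_ediv_add_half_le_jb j k i)
    (neg_nonpos.2 (by positivity))
  have : ((k i / ((2 ^ j : ℕ) : ℤ) : ℤ) : ℝ) + 1 / 2 ≠ 0 := by
    intro h
    have h' : (((2 * (k i / ((2 ^ j : ℕ) : ℤ)) + 1 : ℤ)) : ℝ) = 0 := by
      push_cast at h ⊢; linarith
    have := Int.cast_eq_zero.1 h'
    omega
  positivity

theorem tsum_abs_int_add_half_rpow_lt_top {t : ℝ} (ht : 1 < t) :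
    ∑' q : ℤ, ENNReal.ofReal ((|(q : ℝ) + 1 / 2| / 2) ^ (-t)) < ⊤ := by
  have h := ((Real.summable_one_div_int_add_rpow (1 / 2) t).2 ht).mul_left ((2 : ℝ) ^ t)
  refine (h.congr fun q => ?_).tsum_ofReal_lt_top
  rw [Real.rpow_neg (by positivity), Real.div_rpow (abs_nonneg _) zero_le_two, inv_div, mul_one_div]

theorem exists_tsum_jb_rpow_neg_le {d : ℕ} (hd : 1 ≤ d) {s : ℝ} (hs : d < s) :
    ∃ C : ℝ≥0∞, C < ⊤ ∧ ∀ j : ℕ,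
      ∑' k : Fin d → ℤ, ENNReal.ofReal (jb (pt d j k) ^ (-s)) ≤ ((2 : ℝ≥0∞) ^ j) ^ d * C := by
  have hd0 : (0 : ℝ) < d := by positivity
  refine ⟨_, ENNReal.pow_lt_top (n := d)
    (tsum_abs_int_add_half_rpow_lt_top ((one_lt_div hd0).2 hs)), fun j => ?_⟩
  refine (ENNReal.tsum_le_tsum (jb_rpow_neg_le_prod hd (hd0.le.trans hs.le) j)).trans ?_
  rw [ENNReal.tsum_pi_fin_prod fun m : ℤ => ENNReal.ofReal
      ((|((m / ((2 ^ j : ℕ) : ℤ) : ℤ) : ℝ) + 1 / 2| / 2) ^ (-(s / d))),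
    ENNReal.tsum_int_ediv fun q : ℤ => ENNReal.ofReal ((|(q : ℝ) + 1 / 2| / 2) ^ (-(s / d))),
    mul_pow]
  simp

theorem tsum_two_rpow_mul_tsum_jb_lt_top {d : ℕ} (hd : 1 ≤ d) {s ε : ℝ} (hs : d < s)
    (hε : 0 < ε) :
    ∑' j : ℕ, ENNReal.ofReal ((2 : ℝ) ^ ((j : ℝ) * (-ε - d))) *
      ∑' k : Fin d → ℤ, ENNReal.ofReal (jb (pt d j k) ^ (-s)) < ⊤ := by
  obtain ⟨C, hC, h⟩ := exists_tsum_jb_rpow_neg_le hd hs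
  have hterm (j : ℕ) : ENNReal.ofReal ((2 : ℝ) ^ ((j : ℝ) * (-ε - d))) *
      ∑' k : Fin d → ℤ, ENNReal.ofReal (jb (pt d j k) ^ (-s)) ≤
        ENNReal.ofReal (((2 : ℝ) ^ (-ε)) ^ j) * C := by
    refine (mul_le_mul_right (h j) _).trans_eq ?_
    have h2 : ((2 : ℝ≥0∞) ^ j) ^ d = ENNReal.ofReal ((2 : ℝ) ^ ((j : ℝ) * d)) := by
      rw [Real.rpow_mul zero_le_two, Real.rpow_natCast, Real.rpow_natCast,
        ENNReal.ofReal_pow (by positivity), ENNReal.ofReal_pow zero_le_two]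
      simp
    rw [← mul_assoc, h2, ← ENNReal.ofReal_mul (by positivity), ← Real.rpow_add two_pos,
      ← Real.rpow_mul_natCast zero_le_two]
    ring_nf
  refine (ENNReal.tsum_le_tsum hterm).trans_lt ?_
  rw [ENNReal.tsum_mul_right]
  exact ENNReal.mul_lt_top (summable_geometric_of_lt_one (by positivity)
    (Real.rpow_lt_one_of_one_lt_of_neg one_lt_two (neg_lt_zero.2 hε))).tsum_ofReal_lt_top hC

/-- Young's inequality for a product of powers, with the weights `B ^ e₁ * J ^ (ρ₁ * p₁)`
and `B ^ e₀ * J ^ (ρ₀ * p₀)`. -/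
theorem weighted_rpow_le_add {B J a p₀ p₁ : ℝ} (hB : 0 < B) (hJ : 0 < J) (ha : 0 ≤ a)
    (hp₀ : 0 < p₀) (hp : p₀ < p₁) (e₀ e₁ ρ₀ ρ₁ : ℝ) :
    B ^ e₀ * (J ^ (ρ₀ * p₀) * a ^ p₀) ≤ B ^ e₁ * (J ^ (ρ₁ * p₁) * a ^ p₁) +
      B ^ ((e₀ * p₁ - e₁ * p₀) / (p₁ - p₀)) *
        J ^ (-((ρ₁ - ρ₀) * (p₀ * p₁ / (p₁ - p₀)))) := by
  have hp₁ : 0 < p₁ := hp₀.trans hp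
  have hsub : 0 < p₁ - p₀ := sub_pos.2 hp
  have hpq : (p₁ / p₀).HolderConjugate (p₁ / (p₁ - p₀)) := by
    rw [Real.holderConjugate_iff]
    refine ⟨(one_lt_div hp₀).2 hp, ?_⟩
    field_simp
    ring
  set u := B ^ (e₁ * p₀ / p₁) * (J ^ (ρ₁ * p₀) * a ^ p₀) with hu
  set v := B ^ (e₀ - e₁ * p₀ / p₁) * J ^ (ρ₀ * p₀ - ρ₁ * p₀) with hv
  have hu0 : 0 ≤ u := by positivity
  have hv0 : 0 ≤ v := by positivity
  have huv : B ^ e₀ * (J ^ (ρ₀ * p₀) * a ^ p₀) = u * v := by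
    rw [show e₀ = e₁ * p₀ / p₁ + (e₀ - e₁ * p₀ / p₁) by ring,
      show ρ₀ * p₀ = ρ₁ * p₀ + (ρ₀ * p₀ - ρ₁ * p₀) by ring, Real.rpow_add hB, Real.rpow_add hJ,
      hu, hv]
    ring_nf
  have hup : u ^ (p₁ / p₀) = B ^ e₁ * (J ^ (ρ₁ * p₁) * a ^ p₁) := by
    rw [hu, Real.mul_rpow (by positivity) (by positivity),
      Real.mul_rpow (by positivity) (by positivity), ← Real.rpow_mul hB.le, ← Real.rpow_mul hJ.le,
      ← Real.rpow_mul ha]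
    congr 2 <;> [skip; congr 1; congr 1] <;> field_simp
  have hvq : v ^ (p₁ / (p₁ - p₀)) = B ^ ((e₀ * p₁ - e₁ * p₀) / (p₁ - p₀)) *
      J ^ (-((ρ₁ - ρ₀) * (p₀ * p₁ / (p₁ - p₀)))) := by
    rw [hv, Real.mul_rpow (by positivity) (by positivity), ← Real.rpow_mul hB.le,
      ← Real.rpow_mul hJ.le]
    congr 2 <;> field_simp
    ring
  rw [huv, ← hup, ← hvq]
  refine (Real.young_inequality_of_nonneg hu0 hv0 hpq).trans (add_le_add ?_ ?_)
  · exact div_le_self (by positivity) hpq.lt.le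
  · exact div_le_self (by positivity) hpq.symm.lt.le

/-- Sequence form of the second weighted Besov embedding
`B_{p₁}^{τ₁}(ℝ^d;ρ₁) ⊆ B_{p₀}^{τ₀}(ℝ^d;ρ₀)` when `ρ₁ - ρ₀ > d/p₀ - d/p₁` and `τ₁ > τ₀`. -/
theorem besov_sequence_embedding_two
    (d : ℕ) (hd : 1 ≤ d) (p₀ p₁ : ℝ) (hp₀ : 0 < p₀) (hp : p₀ ≤ p₁)
    (τ₀ τ₁ ρ₀ ρ₁ : ℝ) (hρ : d / p₀ - d / p₁ < ρ₁ - ρ₀) (hτ : τ₀ < τ₁)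
    (a : ℕ → (Fin d → ℤ) → ℝ)
    (hfin : (∑' j : ℕ, ENNReal.ofReal ((2 : ℝ) ^ ((j : ℝ) * (τ₁ * p₁ - d + d * p₁ / 2))) *
        ∑' k : Fin d → ℤ,
          ENNReal.ofReal (jb (pt d j k) ^ (ρ₁ * p₁) * |a j k| ^ p₁)) < ⊤) :
    (∑' j : ℕ, ENNReal.ofReal ((2 : ℝ) ^ ((j : ℝ) * (τ₀ * p₀ - d + d * p₀ / 2))) *
        ∑' k : Fin d → ℤ,
          ENNReal.ofReal (jb (pt d j k) ^ (ρ₀ * p₀) * |a j k| ^ p₀)) < ⊤ := by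
  have hJ (j : ℕ) (k : Fin d → ℤ) : 0 < jb (pt d j k) := zero_lt_one.trans_le (one_le_jb _)
  rcases hp.eq_or_lt with rfl | hp
  · refine lt_of_le_of_lt ?_ hfin
    refine ENNReal.tsum_le_tsum fun j => mul_le_mul' ?_ (ENNReal.tsum_le_tsum fun k => ?_)
    · gcongr
      exact one_le_two
    · have hρ' : ρ₀ ≤ ρ₁ := by linarith
      gcongr
      exact one_le_jb _
  · have hp₁ : 0 < p₁ := hp₀.trans hp
    have hsub : 0 < p₁ - p₀ := sub_pos.2 hp
    set r := p₀ * p₁ / (p₁ - p₀) with hr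
    have hr0 : 0 < r := by positivity
    have hs : (d : ℝ) < (ρ₁ - ρ₀) * r := by
      have h := mul_lt_mul_of_pos_right hρ hr0
      have hd' : ((d : ℝ) / p₀ - d / p₁) * r = d := by
        rw [hr]; field_simp
      rwa [hd'] at h
    have hε : 0 < (τ₁ - τ₀) * r := mul_pos (sub_pos.2 hτ) hr0
    refine lt_of_le_of_lt ?_
      (ENNReal.add_lt_top.2 ⟨hfin, tsum_two_rpow_mul_tsum_jb_lt_top hd hs hε⟩)
    rw [← ENNReal.tsum_add]
    refine ENNReal.tsum_le_tsum fun j => ?_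
    simp only [← ENNReal.tsum_mul_left]
    rw [← ENNReal.tsum_add]
    refine ENNReal.tsum_le_tsum fun k => ?_
    have hJk := hJ j k
    rw [← ENNReal.ofReal_mul (by positivity), ← ENNReal.ofReal_mul (by positivity),
      ← ENNReal.ofReal_mul (by positivity), ← ENNReal.ofReal_add (by positivity) (by positivity)]
    refine ENNReal.ofReal_le_ofReal ?_
    have hexp : (j : ℝ) * (-((τ₁ - τ₀) * r) - d) =
        ((j : ℝ) * (τ₀ * p₀ - d + d * p₀ / 2) * p₁ -
          (j : ℝ) * (τ₁ * p₁ - d + d * p₁ / 2) * p₀) / (p₁ - p₀) := by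
      rw [hr]; field_simp; ring
    rw [hexp]
    exact weighted_rpow_le_add two_pos hJk (abs_nonneg _) hp₀ hp _ _ _ _
end

section
/- Let d ≥ 1, p > 0, and a, b, r ∈ ℝ with r < −d and a + b + d < 0. Let (X_{j,k})_{j∈ℕ, k∈ℤ^d} be real random variables with E[|X_{j,k}|^p] ≤ C 2^{jb} for all j, k, for some constant C < ∞. Then E[ ∑_{j≥0} 2^{ja} ∑_{k∈ℤ^d} ⟨2^{−j}k⟩^{r} |X_{j,k}|^p ] < ∞; in particular ∑_{j≥0} 2^{ja} ∑_{k∈ℤ^d} ⟨2^{−j}k⟩^{r} |X_{j,k}|^p < ∞ almost surely. -/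
open MeasureTheory ENNReal

/-- The series `∑_{m ∈ ℤ^d} (1 + ‖m‖)^r` converges for `r < -d`. -/
lemma summable_one_add_norm_int_rpow (d : ℕ) {r : ℝ} (hr : r < -d) :
    Summable fun m : Fin d → ℤ => (1 + ‖m‖) ^ r := by
  have hr0 : r ≤ 0 := hr.le.trans (neg_nonpos.mpr d.cast_nonneg)
  let b := (Pi.basisFun ℝ (Fin d)).restrictScalars ℤ
  have hrank : Module.finrank ℤ (Submodule.span ℤ (Set.range (Pi.basisFun ℝ (Fin d)))) = d := by
    rw [Module.finrank_eq_card_basis b, Fintype.card_fin]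
  have hL := ZLattice.summable_norm_rpow (Submodule.span ℤ (Set.range (Pi.basisFun ℝ (Fin d)))) r
    (by rwa [hrank])
  have hnorm (m : Fin d → ℤ) : ‖b.equivFun.symm m‖ = ‖m‖ := by
    have hcoe : ((b.equivFun.symm m : _) : Fin d → ℝ) = fun i => (m i : ℝ) := by
      ext i
      simp [b, Module.Basis.equivFun_symm_apply, Finset.sum_apply, Pi.single_apply]
    rw [← Submodule.norm_coe, hcoe]
    simp only [Pi.norm_def, NNReal.coe_inj]
    exact Finset.sup_congr rfl fun i _ => NNReal.eq (Int.norm_cast_real (m i))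
  have hsum : Summable fun m : Fin d → ℤ => ‖m‖ ^ r := by
    simpa only [Function.comp_def, hnorm] using hL.comp_injective b.equivFun.symm.injective
  refine hsum.of_norm_bounded_eventually ?_
  refine (Set.finite_singleton (0 : Fin d → ℤ)).subset fun m hm => ?_
  by_contra h0
  refine hm ?_
  rw [Set.mem_ofPred_eq, Real.norm_of_nonneg (by positivity)]
  exact Real.rpow_le_rpow_of_nonpos (norm_pos_iff.mpr h0) (by linarith) hr0

/-- Rounding `2^{-j} k` down to an integer point decreases the bracket by at most a constant. -/
lemma one_add_norm_ediv_le_jb (d j : ℕ) (k : Fin d → ℤ) :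
    (1 + ‖fun i => k i / (2 : ℤ) ^ j‖) / 4 ≤ jb (pt d j k) := by
  have hfloor : ‖fun i => k i / (2 : ℤ) ^ j‖ ≤ ‖pt d j k‖ + 1 := by
    refine (pi_norm_le_iff_of_nonneg (by positivity)).mpr fun i => ?_
    have hi : |(k i : ℝ) / 2 ^ j| ≤ ‖pt d j k‖ := PiLp.norm_apply_le (pt d j k) i
    have hdiv : k i / (2 : ℤ) ^ j = ⌊(k i : ℝ) / 2 ^ j⌋ := by
      simpa using (Int.floor_div_natCast (k i : ℝ) (2 ^ j)).symm
    rw [hdiv, Int.norm_eq_abs]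
    have h1 := Int.floor_le ((k i : ℝ) / 2 ^ j)
    have h2 := Int.lt_floor_add_one ((k i : ℝ) / 2 ^ j)
    rw [abs_le] at hi ⊢
    constructor <;> linarith
  refine Real.le_sqrt_of_sq_le ?_
  have h0 : 0 ≤ ‖fun i => k i / (2 : ℤ) ^ j‖ := norm_nonneg _
  nlinarith [sq_nonneg (‖pt d j k‖ - 1)]

/-- Splitting `k ∈ ℤ^d` into its quotient and remainder modulo `2^j`: a sum over `ℤ^d` of a
function of the quotient is at most `2^{jd}` times the sum over all quotients. -/
lemma tsum_ediv_two_pow_le (d j : ℕ) (f : (Fin d → ℤ) → ℝ≥0∞) :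
    ∑' k : Fin d → ℤ, f (fun i => k i / (2 : ℤ) ^ j) ≤ (2 ^ j) ^ d * ∑' m, f m := by
  let φ : (Fin d → ℤ) → (Fin d → ZMod (2 ^ j)) × (Fin d → ℤ) :=
    fun k => (fun i => (k i : ZMod (2 ^ j)), fun i => k i / (2 : ℤ) ^ j)
  have hφ : Function.Injective φ := by
    intro k l h
    ext i
    have hmod := (ZMod.intCast_eq_intCast_iff' _ _ _).mp (congrFun (congrArg Prod.fst h) i)
    have hdiv : k i / (2 : ℤ) ^ j = l i / (2 : ℤ) ^ j := congrFun (congrArg Prod.snd h) i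
    push_cast at hmod
    rw [← Int.mul_ediv_add_emod (k i) (2 ^ j), hmod, hdiv, Int.mul_ediv_add_emod]
  refine (ENNReal.tsum_comp_le_tsum_of_injective hφ fun q => f q.2).trans_eq ?_
  simp [ENNReal.tsum_prod', ZMod.card]

/-- `∑_k ⟨2^{-j}k⟩^r ≲ 2^{jd}` uniformly in `j`, for `r < -d`. -/
lemma exists_tsum_jb_rpow_le (d : ℕ) {r : ℝ} (hr : r < -d) :
    ∃ K : ℝ≥0∞, K ≠ ⊤ ∧ ∀ j : ℕ,
      ∑' k : Fin d → ℤ, ENNReal.ofReal (jb (pt d j k) ^ r) ≤ (2 ^ j) ^ d * K := by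
  have hr0 : r ≤ 0 := hr.le.trans (neg_nonpos.mpr d.cast_nonneg)
  refine ⟨∑' m : Fin d → ℤ, ENNReal.ofReal (((1 + ‖m‖) / 4) ^ r), ?_, fun j => ?_⟩
  · refine Summable.tsum_ofReal_ne_top ?_
    refine ((summable_one_add_norm_int_rpow d hr).div_const (4 ^ r)).congr fun m => ?_
    rw [Real.div_rpow (by positivity) (by positivity)]
  · refine le_trans (ENNReal.tsum_le_tsum fun k => ENNReal.ofReal_le_ofReal ?_)
      (tsum_ediv_two_pow_le d j fun m => ENNReal.ofReal (((1 + ‖m‖) / 4) ^ r))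
    exact Real.rpow_le_rpow_of_nonpos (by positivity) (one_add_norm_ediv_le_jb d j k) hr0

/-- If the random variables `X_{j,k}` satisfy the uniform moment bound
`E[|X_{j,k}|^p] ≤ C 2^{jb}`, and `r < -d`, `a + b + d < 0`, then the expected weighted Besov-type
series `∑_j 2^{ja} ∑_k ⟨2^{-j}k⟩^r |X_{j,k}|^p` is finite; in particular it is a.s. finite. -/
theorem besov_sequence_moment_bound_finite
    {Ω : Type*} [MeasurableSpace Ω] (P : Measure Ω) [IsProbabilityMeasure P]
    (d : ℕ) (hd : 1 ≤ d) (p : ℝ) (hp : 0 < p)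
    (a b r : ℝ) (hr : r < -d) (hab : a + b + d < 0)
    (X : ℕ → (Fin d → ℤ) → Ω → ℝ) (hmeas : ∀ j k, Measurable (X j k))
    (C : ℝ)
    (hmom : ∀ j k, ∫⁻ ω, ENNReal.ofReal (|X j k ω| ^ p) ∂P
      ≤ ENNReal.ofReal (C * 2 ^ ((j : ℝ) * b))) :
    (∫⁻ ω, (∑' j : ℕ, ENNReal.ofReal ((2 : ℝ) ^ ((j : ℝ) * a)) *
        ∑' k : Fin d → ℤ,
          ENNReal.ofReal (jb (pt d j k) ^ r * |X j k ω| ^ p)) ∂P) < ⊤ ∧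
    ∀ᵐ ω ∂P, (∑' j : ℕ, ENNReal.ofReal ((2 : ℝ) ^ ((j : ℝ) * a)) *
        ∑' k : Fin d → ℤ,
          ENNReal.ofReal (jb (pt d j k) ^ r * |X j k ω| ^ p)) < ⊤ := by
  obtain ⟨K, hK, hKj⟩ := exists_tsum_jb_rpow_le d hr
  have hXmeas (j : ℕ) (k : Fin d → ℤ) :
      Measurable fun ω => ENNReal.ofReal (jb (pt d j k) ^ r * |X j k ω| ^ p) := by
    have := hmeas j k
    fun_prop
  have hsmeas (j : ℕ) : Measurable fun ω => ∑' k : Fin d → ℤ,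
      ENNReal.ofReal (jb (pt d j k) ^ r * |X j k ω| ^ p) := Measurable.tsum (hXmeas j)
  have hmain : (∫⁻ ω, (∑' j : ℕ, ENNReal.ofReal ((2 : ℝ) ^ ((j : ℝ) * a)) *
      ∑' k : Fin d → ℤ,
        ENNReal.ofReal (jb (pt d j k) ^ r * |X j k ω| ^ p)) ∂P) < ⊤ := by
    rw [lintegral_tsum fun j => ((hsmeas j).const_mul _).aemeasurable]
    have hterm (j : ℕ) : ∫⁻ ω, ENNReal.ofReal ((2 : ℝ) ^ ((j : ℝ) * a)) *
        ∑' k : Fin d → ℤ, ENNReal.ofReal (jb (pt d j k) ^ r * |X j k ω| ^ p) ∂P ≤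
        K * ENNReal.ofReal C * ENNReal.ofReal ((2 : ℝ) ^ (a + b + d)) ^ j := by
      rw [lintegral_const_mul _ (hsmeas j), lintegral_tsum fun k => (hXmeas j k).aemeasurable]
      have hk (k : Fin d → ℤ) : ∫⁻ ω, ENNReal.ofReal (jb (pt d j k) ^ r * |X j k ω| ^ p) ∂P ≤
          ENNReal.ofReal (jb (pt d j k) ^ r) * ENNReal.ofReal (C * 2 ^ ((j : ℝ) * b)) := by
        have hjb : 0 ≤ jb (pt d j k) ^ r := Real.rpow_nonneg (Real.sqrt_nonneg _) r
        simp_rw [ENNReal.ofReal_mul hjb]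
        rw [lintegral_const_mul' _ _ ENNReal.ofReal_ne_top]
        gcongr
        exact hmom j k
      have hpow : ENNReal.ofReal ((2 : ℝ) ^ (a + b + d)) ^ j =
          ENNReal.ofReal ((2 : ℝ) ^ ((j : ℝ) * a)) * (2 ^ j) ^ d *
            ENNReal.ofReal ((2 : ℝ) ^ ((j : ℝ) * b)) := by
        have h2 : ((2 : ℝ≥0∞) ^ j) ^ d = ENNReal.ofReal (2 ^ ((j : ℝ) * d)) := by
          rw [← pow_mul, ← Nat.cast_mul, Real.rpow_natCast, ENNReal.ofReal_pow zero_le_two,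
            ENNReal.ofReal_ofNat]
        rw [h2, ← ENNReal.ofReal_pow (by positivity), ← ENNReal.ofReal_mul (by positivity),
          ← ENNReal.ofReal_mul (by positivity), ← Real.rpow_add two_pos, ← Real.rpow_add two_pos,
          ← Real.rpow_mul_natCast zero_le_two]
        ring_nf
      calc _ ≤ ENNReal.ofReal ((2 : ℝ) ^ ((j : ℝ) * a)) *
            (((2 ^ j) ^ d * K) * ENNReal.ofReal (C * 2 ^ ((j : ℝ) * b))) := by
            grw [ENNReal.tsum_le_tsum hk, ENNReal.tsum_mul_right, hKj j]
        _ = _ := by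
            rw [ENNReal.ofReal_mul' (by positivity), hpow]
            ring
    grw [ENNReal.tsum_le_tsum hterm, ENNReal.tsum_mul_left]
    refine ENNReal.mul_lt_top (ENNReal.mul_lt_top hK.lt_top ENNReal.ofReal_lt_top) ?_
    rw [tsum_geometric_lt_top, ENNReal.ofReal_lt_one]
    exact Real.rpow_lt_one_of_one_lt_of_neg one_lt_two hab
  exact ⟨hmain, ae_lt_top (Measurable.tsum fun j => (hsmeas j).const_mul _) hmain.ne⟩
end
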